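/- arXiv:2411.04124 — 2 statements merged into one kernel-verified Lean document; each statement's English description precedes it below -/
import Mathlib

section
/- Correctness of the Karp reduction from (1−ε, 1−ε^c)-gap Max-Cut to approximate CVP: let ε, c ∈ (0,1), suppose the edge list covers vertices, and assume the gap promise that either some b ∈ {0,1}^n has cut(b) ≥ (1−ε)·m, or every b ∈ {0,1}^n has cut(b) < (1−ε^c)·m. Then there exists y ∈ ℤ^n with ‖B·y − t‖_p ≤ (m·(1 + ε·(ι^p − 1)))^{1/p} if and only if some b ∈ {0,1}^n has cut(b) ≥ (1−ε)·m. -/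
open Finset Matrix

/-- The matrix of the (unweighted) Max-Cut-to-CVP reduction. The ambient
dimension `2m` is indexed by `Fin m × Bool`, where `(k, false)` is the
coordinate `2k-1` and `(k, true)` is the coordinate `2k` of the paper. -/
noncomputable def Bmat {n m : ℕ} (ι : ℝ) (E : Fin m → Fin n × Fin n) :
    Matrix (Fin m × Bool) (Fin n) ℝ := fun j i =>
  if j.2 then
    (if i = (E j.1).1 then ι else 0) + (if i = (E j.1).2 then ι else 0)
  else
    (if i = (E j.1).1 then (-1 : ℝ) else 0) + (if i = (E j.1).2 then 1 else 0)

/-- The target vector of the reduction: `t_{2k-1} = 0`, `t_{2k} = ι`. -/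
noncomputable def tvec (m : ℕ) (ι : ℝ) : Fin m × Bool → ℝ := fun j => if j.2 then ι else 0

/-- The `ℓ_p` norm `(∑ j, |x j| ^ p) ^ (1/p)` (real exponents). -/
noncomputable def lpNorm {d : Type*} [Fintype d] (p : ℝ) (x : d → ℝ) : ℝ :=
  (∑ j, |x j| ^ p) ^ (1 / p)

/-- A binary vector `b ∈ {0,1}^n`, as a real vector. -/
def binVec {n : ℕ} (b : Fin n → Bool) : Fin n → ℝ := fun i => if b i then 1 else 0

/-- An integer vector `y ∈ ℤ^n`, as a real vector. -/
def intVec {n : ℕ} (y : Fin n → ℤ) : Fin n → ℝ := fun i => (y i : ℝ)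

/-- The number of edges cut by the partition described by `b`. -/
def cut {n m : ℕ} (E : Fin m → Fin n × Fin n) (b : Fin n → Bool) : ℕ :=
  (Finset.univ.filter fun k => b (E k).1 ≠ b (E k).2).card

/-- The edge list covers vertices: every vertex is an endpoint of some edge. -/
def Covers {n m : ℕ} (E : Fin m → Fin n × Fin n) : Prop :=
  ∀ i : Fin n, ∃ k : Fin m, (E k).1 = i ∨ (E k).2 = i

/-- The binarization of an integer vector: `0` if `y i ≤ 0`, `1` if `y i ≥ 1`. -/
def binarize {n : ℕ} (y : Fin n → ℤ) : Fin n → Bool := fun i => decide (1 ≤ y i)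

/-- The cost of the edge `k` in `∑ j, |(B y - t) j| ^ p`. -/
lemma sum_abs_residual_rpow {n m : ℕ} (p ι : ℝ) (hι : 0 ≤ ι) (E : Fin m → Fin n × Fin n)
    (y : Fin n → ℤ) :
    ∑ j, |((Bmat ι E).mulVec (intVec y) - tvec m ι) j| ^ p =
      ∑ k, (ι ^ p * (|y (E k).1 + y (E k).2 - 1| : ℝ) ^ p +
        (|(y (E k).2 - y (E k).1 : ℝ)|) ^ p) := by
  rw [Fintype.sum_prod_type]
  refine Finset.sum_congr rfl fun k _ => ?_
  rw [Fintype.sum_bool]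
  congr 1
  · have habs (x : ℝ) : ι * |x| = |ι * x| := by rw [abs_mul, abs_of_nonneg hι]
    rw [← Real.mul_rpow hι (abs_nonneg _), habs]
    congr 2
    simp [Matrix.mulVec, dotProduct, Bmat, intVec, tvec, add_mul, Finset.sum_add_distrib]
    ring
  · congr 2
    simp [Matrix.mulVec, dotProduct, Bmat, intVec, tvec, add_mul, Finset.sum_add_distrib]
    ring

lemma one_le_abs_intCast_rpow {p : ℝ} (hp : 0 ≤ p) {z : ℤ} (hz : z ≠ 0) :
    1 ≤ |(z : ℝ)| ^ p :=
  Real.one_le_rpow (by exact_mod_cast Int.one_le_abs hz) hp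

/-- An edge costs at least `1` if the binarization of `y` cuts it, and at least `ι ^ p` if not. -/
lemma ite_le_edge_cost {p ι : ℝ} (hp : 0 ≤ p) (hι : 1 ≤ ι) (a b : ℤ) :
    (if decide (1 ≤ a) ≠ decide (1 ≤ b) then 1 else ι ^ p) ≤
      ι ^ p * |(a + b - 1 : ℝ)| ^ p + |(b - a : ℝ)| ^ p := by
  have hιp : 1 ≤ ι ^ p := Real.one_le_rpow hι hp
  have hs : 0 ≤ |(a + b - 1 : ℝ)| ^ p := by positivity
  have hd : 0 ≤ |(b - a : ℝ)| ^ p := by positivity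
  by_cases h : a + b - 1 = 0
  · have hba : 1 ≤ |(b - a : ℝ)| ^ p := by
      simpa using one_le_abs_intCast_rpow hp (z := b - a) (by omega)
    have hcut : decide (1 ≤ a) ≠ decide (1 ≤ b) := by
      rw [ne_eq, decide_eq_decide]; omega
    rw [if_pos hcut]
    nlinarith
  · have hab : 1 ≤ |(a + b - 1 : ℝ)| ^ p := by
      simpa using one_le_abs_intCast_rpow hp h
    split_ifs <;> nlinarith

/-- A binary vector attains the minimal edge cost. -/
lemma edge_cost_toInt {p : ℝ} (hp : p ≠ 0) (ι : ℝ) (a b : Bool) :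
    ι ^ p * |((if a then 1 else 0 : ℤ) + (if b then 1 else 0 : ℤ) - 1 : ℝ)| ^ p +
      |((if b then 1 else 0 : ℤ) - (if a then 1 else 0 : ℤ) : ℝ)| ^ p =
      if a ≠ b then 1 else ι ^ p := by
  cases a <;> cases b <;> simp [hp]

lemma sum_ite_cut {n m : ℕ} (E : Fin m → Fin n × Fin n) (b : Fin n → Bool) (x : ℝ) :
    ∑ k, (if b (E k).1 ≠ b (E k).2 then 1 else x) = m * x - cut E b * (x - 1) := by
  have h : ∀ k, (if b (E k).1 ≠ b (E k).2 then 1 else x) =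
      x - if b (E k).1 ≠ b (E k).2 then x - 1 else 0 := fun k => by split_ifs <;> ring
  simp_rw [h, Finset.sum_sub_distrib, ← Finset.sum_filter, Finset.sum_const, cut]
  simp

/-- correctness of the Karp reduction from gap Max-Cut to CVP. -/
theorem stmt7 (n m : ℕ) (hn : 0 < n) (hm : 0 < m) (p : ℝ) (hp : 1 ≤ p) (ι : ℝ) (hι : 1 < ι)
    (E : Fin m → Fin n × Fin n) (hE : ∀ k, (E k).1 ≠ (E k).2)
    (ε c : ℝ) (hε : 0 < ε) (hε1 : ε < 1) (hc : 0 < c) (hc1 : c < 1)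
    (hcov : Covers E)
    (hpromise : (∃ b : Fin n → Bool, (1 - ε) * (m : ℝ) ≤ (cut E b : ℝ)) ∨
      (∀ b : Fin n → Bool, (cut E b : ℝ) < (1 - ε ^ c) * (m : ℝ))) :
    (∃ y : Fin n → ℤ, lpNorm p ((Bmat ι E).mulVec (intVec y) - tvec m ι)
        ≤ ((m : ℝ) * (1 + ε * (ι ^ p - 1))) ^ (1 / p)) ↔
      ∃ b : Fin n → Bool, (1 - ε) * (m : ℝ) ≤ (cut E b : ℝ) := by
  have hp0 : 0 < p := by linarith
  have hιp : 0 < ι ^ p - 1 := sub_pos.2 (Real.one_lt_rpow hι hp0)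
  have hnorm (y : Fin n → ℤ) : lpNorm p ((Bmat ι E).mulVec (intVec y) - tvec m ι)
        ≤ ((m : ℝ) * (1 + ε * (ι ^ p - 1))) ^ (1 / p) ↔
      ∑ k, (ι ^ p * (|y (E k).1 + y (E k).2 - 1| : ℝ) ^ p +
        (|(y (E k).2 - y (E k).1 : ℝ)|) ^ p) ≤ m * (1 + ε * (ι ^ p - 1)) := by
    rw [lpNorm, sum_abs_residual_rpow p ι (by linarith) E y]
    exact Real.rpow_le_rpow_iff (by positivity) (by positivity) (by positivity)
  have hcut (b : Fin n → Bool) :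
      ∑ k, (if b (E k).1 ≠ b (E k).2 then 1 else ι ^ p) ≤ m * (1 + ε * (ι ^ p - 1)) ↔
        (1 - ε) * (m : ℝ) ≤ cut E b := by
    rw [sum_ite_cut, ← mul_le_mul_iff_left₀ hιp (b := (1 - ε) * (m : ℝ))]
    constructor <;> intro h <;> linarith
  constructor
  · rintro ⟨y, hy⟩
    refine ⟨binarize y, (hcut _).1 (le_trans (Finset.sum_le_sum fun k _ => ?_) ((hnorm y).1 hy))⟩
    exact ite_le_edge_cost hp0.le hι.le _ _
  · rintro ⟨b, hb⟩
    refine ⟨fun i => if b i then 1 else 0, (hnorm _).2 ?_⟩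
    simp_rw [edge_cost_toInt hp0.ne']
    exact (hcut b).2 hb
end

section
/- Weighted distance formula: for every binary coefficient vector b ∈ {0,1}^n, Σ_{j=1}^{2m} |(B·b − t)_j|^p = cut(b) + ι^p · Σ_{k : b does not cut edge k} w k; that is, each cut edge contributes 1 and each uncut edge k contributes ι^p · w k to the p-th power of the ℓ_p distance from B·b to the target t. -/
open Finset Matrix

/-- The matrix of the weighted Max-Cut-to-CVP reduction, with `ω k = (w k)^(1/p)`.
The ambient dimension `2m` is indexed by `Fin m × Bool`, where `(k, false)` is the
coordinate `2k-1` and `(k, true)` is the coordinate `2k` of the paper. -/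
noncomputable def BmatW {n m : ℕ} (p ι : ℝ) (E : Fin m → Fin n × Fin n) (w : Fin m → ℝ) :
    Matrix (Fin m × Bool) (Fin n) ℝ := fun j i =>
  if j.2 then
    (if i = (E j.1).1 then ι * (w j.1) ^ (1 / p) else 0) +
      (if i = (E j.1).2 then ι * (w j.1) ^ (1 / p) else 0)
  else
    (if i = (E j.1).1 then (-1 : ℝ) else 0) + (if i = (E j.1).2 then 1 else 0)

/-- The target vector of the weighted reduction: `t_{2k-1} = 0`, `t_{2k} = ι·ω k`. -/
noncomputable def tvecW (m : ℕ) (p ι : ℝ) (w : Fin m → ℝ) : Fin m × Bool → ℝ :=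
  fun j => if j.2 then ι * (w j.1) ^ (1 / p) else 0

theorem BmatW_mulVec_true {n m : ℕ} (p ι : ℝ) (E : Fin m → Fin n × Fin n) (w : Fin m → ℝ)
    (x : Fin n → ℝ) (k : Fin m) :
    (BmatW p ι E w).mulVec x (k, true) = ι * w k ^ (1 / p) * (x (E k).1 + x (E k).2) := by
  simp [BmatW, Matrix.mulVec, dotProduct, add_mul, Finset.sum_add_distrib, mul_add]

theorem BmatW_mulVec_false {n m : ℕ} (p ι : ℝ) (E : Fin m → Fin n × Fin n) (w : Fin m → ℝ)
    (x : Fin n → ℝ) (k : Fin m) :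
    (BmatW p ι E w).mulVec x (k, false) = x (E k).2 - x (E k).1 := by
  simp [BmatW, Matrix.mulVec, dotProduct, add_mul, Finset.sum_add_distrib]
  ring

theorem edge_contribution {n m : ℕ} {p ι : ℝ} (hp : p ≠ 0) (hι : 0 ≤ ι)
    (E : Fin m → Fin n × Fin n) {w : Fin m → ℝ} {k : Fin m} (hw : 0 ≤ w k) (b : Fin n → Bool) :
    |((BmatW p ι E w).mulVec (binVec b) - tvecW m p ι w) (k, true)| ^ p +
        |((BmatW p ι E w).mulVec (binVec b) - tvecW m p ι w) (k, false)| ^ p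
      = (if b (E k).1 ≠ b (E k).2 then 1 else 0) +
        if b (E k).1 = b (E k).2 then ι ^ p * w k else 0 := by
  have hω : 0 ≤ w k ^ (1 / p) := Real.rpow_nonneg hw _
  have hpow : |ι * w k ^ (1 / p)| ^ p = ι ^ p * w k := by
    rw [abs_of_nonneg (mul_nonneg hι hω), Real.mul_rpow hι hω, ← Real.rpow_mul hw,
      one_div_mul_cancel hp, Real.rpow_one]
  have hdouble : ι * w k ^ (1 / p) * (1 + 1) - ι * w k ^ (1 / p) = ι * w k ^ (1 / p) := by ring
  simp only [Pi.sub_apply, BmatW_mulVec_true, BmatW_mulVec_false, tvecW, binVec]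
  cases b (E k).1 <;> cases b (E k).2 <;>
    simp only [reduceIte, Bool.false_eq_true, ne_eq, not_true_eq_false, Bool.true_eq_false,
      not_false_eq_true, hdouble, hpow, add_zero, zero_add, mul_zero, mul_one,
      sub_zero, zero_sub, sub_self, abs_neg, abs_zero, abs_one, Real.one_rpow, Real.zero_rpow hp]

/-- weighted distance formula: each cut edge contributes `1`, each
uncut edge `k` contributes `ι^p · w k`. -/
theorem stmt13 (n m : ℕ) (hn : 0 < n) (hm : 0 < m) (p : ℝ) (hp : 1 ≤ p) (ι : ℝ) (hι : 1 < ι)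
    (E : Fin m → Fin n × Fin n) (hE : ∀ k, (E k).1 ≠ (E k).2)
    (w : Fin m → ℝ) (hw : ∀ k, 1 ≤ w k)
    (b : Fin n → Bool) :
    ∑ j, |((BmatW p ι E w).mulVec (binVec b) - tvecW m p ι w) j| ^ p
      = (cut E b : ℝ) +
        ι ^ p * ∑ k ∈ Finset.univ.filter (fun k => b (E k).1 = b (E k).2), w k := by
  have hcut : (cut E b : ℝ) = ∑ k, if b (E k).1 ≠ b (E k).2 then (1 : ℝ) else 0 := by
    rw [cut, Finset.natCast_card_filter]
  rw [Fintype.sum_prod_type, hcut, Finset.mul_sum, Finset.sum_filter, ← Finset.sum_add_distrib]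
  refine Finset.sum_congr rfl fun k _ => ?_
  rw [Fintype.sum_bool]
  exact edge_contribution (by linarith) (by linarith) E (by linarith [hw k]) b
end
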